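/- The linear operator field L(x,y,z) = [[x,−z,−y],[y,0,−y],[0,0,z]] on ℝ³ is a Nijenhuis operator; the coefficients of its characteristic polynomial are σ₁ = −x−z, σ₂ = xz+yz, σ₃ = −yz², and these three polynomials are algebraically independent over ℝ. Consequently the algebra with relations η₁⋆η₁ = η₁, η₁⋆η₂ = η₂, η₂⋆η₃ = −η₁, η₃⋆η₂ = −η₁−η₂, η₃⋆η₃ = η₃ (other products zero) is a differentially non-degenerate LSA. -/

import Mathlib

open Matrix

/-- Components `N^i_{jk}` of the Nijenhuis torsion of a matrix-valued operator
field `L` on `ℝⁿ` (with `L x i j = L^i_j(x)`). -/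
noncomputable def nijTorsion {n : ℕ} (L : (Fin n → ℝ) → Matrix (Fin n) (Fin n) ℝ)
    (x : Fin n → ℝ) (i j k : Fin n) : ℝ :=
  ∑ s : Fin n,
    (L x s j * fderiv ℝ (fun y => L y i k) x (Pi.single s 1)
      - L x s k * fderiv ℝ (fun y => L y i j) x (Pi.single s 1)
      - L x i s * fderiv ℝ (fun y => L y s k) x (Pi.single j 1)
      + L x i s * fderiv ℝ (fun y => L y s j) x (Pi.single k 1))

/-- `L` is a Nijenhuis operator: its Nijenhuis torsion vanishes identically. -/
def IsNijenhuis {n : ℕ} (L : (Fin n → ℝ) → Matrix (Fin n) (Fin n) ℝ) : Prop :=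
  ∀ x i j k, nijTorsion L x i j k = 0

/-- Bilinear product on `ℝⁿ` with structure constants `a i j k`
(`ηᵢ ⋆ ηⱼ = ∑ₖ a i j k • ηₖ`). -/
def mulSC {n : ℕ} (a : Fin n → Fin n → Fin n → ℝ) (ξ η : Fin n → ℝ) : Fin n → ℝ :=
  fun k => ∑ i : Fin n, ∑ j : Fin n, a i j k * ξ i * η j

/-- Left-symmetry: the associator is symmetric in its first two arguments. -/
def IsLSA {n : ℕ} (a : Fin n → Fin n → Fin n → ℝ) : Prop :=
  ∀ ξ η ζ : Fin n → ℝ,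
    mulSC a (mulSC a ξ η) ζ - mulSC a ξ (mulSC a η ζ)
      = mulSC a (mulSC a η ξ) ζ - mulSC a η (mulSC a ξ ζ)

/-- The right-adjoint operator field of the algebra with structure constants `a`:
`(R x) k i = ∑ j, a i j k * x j`, i.e. `(R x).mulVec ξ = ξ ⋆ x`. -/
def rightAdj {n : ℕ} (a : Fin n → Fin n → Fin n → ℝ) (x : Fin n → ℝ) :
    Matrix (Fin n) (Fin n) ℝ :=
  Matrix.of fun k i => ∑ j : Fin n, a i j k * x j

/-- `charCoeff L i` is the coefficient `σ_{i+1}` of `t^(n-1-i)` in the characteristic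
polynomial `χ_{L(x)}(t) = tⁿ + σ₁(x) tⁿ⁻¹ + ⋯ + σₙ(x)` of `L(x)`. -/
noncomputable def charCoeff {n : ℕ} (L : (Fin n → ℝ) → Matrix (Fin n) (Fin n) ℝ)
    (i : Fin n) : (Fin n → ℝ) → ℝ :=
  fun x => (L x).charpoly.coeff (n - 1 - (i : ℕ))

/-- A (structure-constant) algebra is differentially non-degenerate if the coefficients
of the characteristic polynomial of its right-adjoint operator are algebraically
independent over `ℝ` (as elements of the algebra of real-valued functions). -/
def DiffNonDeg {n : ℕ} (a : Fin n → Fin n → Fin n → ℝ) : Prop :=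
  AlgebraicIndependent ℝ (charCoeff (rightAdj a))

/-- Isomorphism of the algebras on `ℝⁿ` with structure constants `a` and `b`. -/
def AlgIsoSC {n : ℕ} (a b : Fin n → Fin n → Fin n → ℝ) : Prop :=
  ∃ φ : (Fin n → ℝ) ≃ₗ[ℝ] (Fin n → ℝ),
    ∀ ξ η : Fin n → ℝ, φ (mulSC a ξ η) = mulSC b (φ ξ) (φ η)

/-- Jacobi matrix of a family of functions `σ` on `ℝⁿ`: `J i j = ∂σᵢ/∂xⱼ`. -/
noncomputable def jacobiMat {n : ℕ} (σ : Fin n → (Fin n → ℝ) → ℝ) (x : Fin n → ℝ) :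
    Matrix (Fin n) (Fin n) ℝ :=
  Matrix.of fun i j => fderiv ℝ (σ i) x (Pi.single j 1)

/-- Companion-type matrix with first column `(-s 0, …, -s (n-1))ᵀ`, ones on the
superdiagonal and zeros elsewhere. -/
def companionS {n : ℕ} (s : Fin n → ℝ) : Matrix (Fin n) (Fin n) ℝ :=
  Matrix.of fun i j => if (j : ℕ) = 0 then -s i else if (j : ℕ) = (i : ℕ) + 1 then 1 else 0

/-- The operator field of the third indecomposable algebra. -/
def Lop (x : Fin 3 → ℝ) : Matrix (Fin 3) (Fin 3) ℝ :=
  Matrix.of ![![x 0, -x 2, -x 1], ![x 1, 0, -x 1], ![0, 0, x 2]]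

/-- Structure constants of the third indecomposable algebra. -/
def sc : Fin 3 → Fin 3 → Fin 3 → ℝ :=
  ![![![1,0,0], ![0,1,0], ![0,0,0]],
    ![![0,0,0], ![0,0,0], ![-1,0,0]],
    ![![0,0,0], ![-1,-1,0], ![0,0,1]]]

open Polynomial in
theorem Matrix.charpoly_fin_three {R : Type*} [CommRing R] (A : Matrix (Fin 3) (Fin 3) R) :
    A.charpoly = X ^ 3 + C (-A 0 0 - A 1 1 - A 2 2) * X ^ 2
      + C (A 0 0 * A 1 1 - A 0 1 * A 1 0 + A 0 0 * A 2 2 - A 0 2 * A 2 0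
        + A 1 1 * A 2 2 - A 1 2 * A 2 1) * X + C (-A.det) := by
  simp [Matrix.charpoly, Matrix.det_fin_three]
  ring

theorem exists_cubic_root (a b c : ℝ) : ∃ z : ℝ, z ^ 3 + a * z ^ 2 + b * z + c = 0 := by
  set M : ℝ := 1 + |a| + |b| + |c| with hM
  have ha := abs_nonneg a
  have hb := abs_nonneg b
  have hc := abs_nonneg c
  have hM1 : 1 ≤ M := by linarith
  have hcubic : |a| * M ^ 2 + |b| * M + |c| ≤ M ^ 3 := by
    have hb' : |b| * M ≤ |b| * M ^ 2 := by gcongr; nlinarith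
    have hc' : |c| * 1 ≤ |c| * M ^ 2 := by gcongr; nlinarith
    have : M ^ 3 = (1 + |a| + |b| + |c|) * M ^ 2 := by rw [← hM]; ring
    nlinarith [sq_nonneg M]
  have haM : |a * M ^ 2| = |a| * M ^ 2 := by rw [abs_mul, abs_of_nonneg (sq_nonneg M)]
  have hbM : |b * M| = |b| * M := by rw [abs_mul, abs_of_nonneg (by linarith : 0 ≤ M)]
  have hlow : (-M) ^ 3 + a * (-M) ^ 2 + b * (-M) + c ≤ 0 := by
    nlinarith [le_abs_self (a * M ^ 2), neg_abs_le (b * M), le_abs_self c]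
  have hhigh : 0 ≤ M ^ 3 + a * M ^ 2 + b * M + c := by
    nlinarith [neg_abs_le (a * M ^ 2), neg_abs_le (b * M), neg_abs_le c]
  have hcont : Continuous fun z : ℝ => z ^ 3 + a * z ^ 2 + b * z + c := by fun_prop
  exact mem_range_of_exists_le_of_exists_ge hcont ⟨_, hlow⟩ ⟨_, hhigh⟩

theorem MvPolynomial.aeval_pi_apply {σ ι R : Type*} [CommRing R]
    (f : σ → ι → R) (p : MvPolynomial σ R) (x : ι) :
    MvPolynomial.aeval f p x = MvPolynomial.eval (fun i => f i x) p := by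
  induction p using MvPolynomial.induction_on with
  | C a => simp
  | add p q hp hq => simp [hp, hq]
  | mul_X p i hp => simp [hp]

theorem algebraicIndependent_of_forall_exists {n ι : Type*} {f : n → ι → ℝ}
    {q : MvPolynomial n ℝ} (hq : q ≠ 0)
    (h : ∀ s : n → ℝ, MvPolynomial.eval s q ≠ 0 → ∃ x, ∀ i, f i x = s i) :
    AlgebraicIndependent ℝ f := by
  rw [algebraicIndependent_iff]
  intro p hp
  refine (mul_eq_zero.mp (MvPolynomial.funext fun s => ?_ : p * q = 0)).resolve_right hq
  by_cases hs : MvPolynomial.eval s q = 0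
  · simp [hs]
  · obtain ⟨x, hx⟩ := h s hs
    have := congrFun hp x
    rw [MvPolynomial.aeval_pi_apply, funext hx] at this
    simpa [hs] using this

theorem algebraicIndependent_charpoly_coeffs :
    AlgebraicIndependent ℝ
      ![(fun x : Fin 3 → ℝ => -x 0 - x 2),
        (fun x : Fin 3 → ℝ => x 0 * x 2 + x 1 * x 2),
        (fun x : Fin 3 → ℝ => -(x 1 * x 2 ^ 2))] := by
  refine algebraicIndependent_of_forall_exists (MvPolynomial.X_ne_zero (2 : Fin 3))
    fun s hs => ?_
  rw [MvPolynomial.eval_X] at hs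
  obtain ⟨z, hz⟩ := exists_cubic_root (s 0) (s 1) (s 2)
  have hz0 : z ≠ 0 := by
    rintro rfl
    exact hs (by simpa using hz)
  refine ⟨![-s 0 - z, s 1 / z + s 0 + z, z], fun i => ?_⟩
  fin_cases i
  · simp
  · simp
    field_simp
    ring
  · simp
    field_simp
    linarith

theorem fderiv_Lop (x v : Fin 3 → ℝ) (i k : Fin 3) :
    fderiv ℝ (fun y => Lop y i k) x v = Lop v i k := by
  let φ : (Fin 3 → ℝ) →ₗ[ℝ] ℝ :=
    { toFun := fun y => Lop y i k
      map_add' := fun y z => by fin_cases i <;> fin_cases k <;> simp [Lop] <;> ring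
      map_smul' := fun c y => by fin_cases i <;> fin_cases k <;> simp [Lop] }
  change fderiv ℝ φ.toContinuousLinearMap x v = φ.toContinuousLinearMap v
  rw [ContinuousLinearMap.fderiv]

theorem isNijenhuis_Lop : IsNijenhuis Lop := by
  intro x i j k
  simp only [nijTorsion, fderiv_Lop, Fin.sum_univ_three]
  fin_cases i <;> fin_cases j <;> fin_cases k <;> simp [Lop]

open Polynomial in
theorem Polynomial.coeff_monic_cubic {R : Type*} [CommRing R] (a b c : R) (n : ℕ) :
    (X ^ 3 + C a * X ^ 2 + C b * X + C c : R[X]).coeff n =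
      (if n = 3 then 1 else 0) + (if n = 2 then a else 0) + (if n = 1 then b else 0)
        + (if n = 0 then c else 0) := by
  simp [coeff_X_pow, coeff_X, coeff_C, eq_comm]

theorem charCoeff_Lop_zero (x : Fin 3 → ℝ) : charCoeff Lop 0 x = -x 0 - x 2 := by
  rw [charCoeff, Matrix.charpoly_fin_three, Polynomial.coeff_monic_cubic]
  simp [Lop]

theorem charCoeff_Lop_one (x : Fin 3 → ℝ) :
    charCoeff Lop 1 x = x 0 * x 2 + x 1 * x 2 := by
  rw [charCoeff, Matrix.charpoly_fin_three, Polynomial.coeff_monic_cubic]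
  simp [Lop]
  ring

theorem charCoeff_Lop_two (x : Fin 3 → ℝ) : charCoeff Lop 2 x = -(x 1 * x 2 ^ 2) := by
  rw [charCoeff, Matrix.charpoly_fin_three, Polynomial.coeff_monic_cubic]
  simp [Lop, Matrix.det_fin_three]
  ring

theorem rightAdj_sc : rightAdj sc = Lop := by
  ext x i k
  fin_cases i <;> fin_cases k <;> simp [rightAdj, sc, Lop, Fin.sum_univ_three]

theorem isLSA_sc : IsLSA sc := by
  intro ξ η ζ
  ext k
  fin_cases k <;> simp [mulSC, sc, Fin.sum_univ_three] <;> ring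

theorem diffNonDeg_sc : DiffNonDeg sc := by
  unfold DiffNonDeg
  rw [rightAdj_sc]
  convert algebraicIndependent_charpoly_coeffs using 1
  funext i x
  fin_cases i
  · exact charCoeff_Lop_zero x
  · exact charCoeff_Lop_one x
  · exact charCoeff_Lop_two x

/-- The operator field is a Nijenhuis operator; the coefficients of its
characteristic polynomial are the stated polynomials, which are algebraically
independent over `ℝ`; it is the right-adjoint operator of the stated algebra,
which is consequently a differentially non-degenerate LSA. -/
theorem stmt14 :
    IsNijenhuis Lop ∧
    (∀ x : Fin 3 → ℝ, charCoeff Lop 0 x = -x 0 - x 2) ∧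
    (∀ x : Fin 3 → ℝ, charCoeff Lop 1 x = x 0 * x 2 + x 1 * x 2) ∧
    (∀ x : Fin 3 → ℝ, charCoeff Lop 2 x = -(x 1 * x 2 ^ 2)) ∧
    AlgebraicIndependent ℝ
      ![(fun x : Fin 3 → ℝ => -x 0 - x 2),
        (fun x : Fin 3 → ℝ => x 0 * x 2 + x 1 * x 2),
        (fun x : Fin 3 → ℝ => -(x 1 * x 2 ^ 2))] ∧
    rightAdj sc = Lop ∧ IsLSA sc ∧ DiffNonDeg sc := by
  exact ⟨isNijenhuis_Lop, charCoeff_Lop_zero, charCoeff_Lop_one, charCoeff_Lop_two,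
    algebraicIndependent_charpoly_coeffs, rightAdj_sc, isLSA_sc, diffNonDeg_sc⟩
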